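/- Let (A, [·,·], ∧) be a Gerstenhaber algebra, E the graded vector space with E_{−k} := A^k, 𝒩_k(P_1,…,P_k) := P_1∧⋯∧P_k, l_1 := 0, l_2(P_1,P_2) := (−1)^{|P_1|}[P_1,P_2], and l_i := ι_{l_2}𝒩_{i−1} for i > 2. Then for any real coefficients (b_i)_{i≥1}, the form 𝒩 := Σ_{i≥1} b_i 𝒩_i is co-boundary Nijenhuis with respect to l_n for every n ≥ 1, with square 𝒦 = Σ_{i,j≥1} b_i b_j · (binom(i+n−2, i) · binom(i+j+n−3, j) / binom(i+j+n−3, i+j−1)) · 𝒩_{i+j−1}, i.e. [𝒩, [𝒩, l_n]_RN]_RN = [𝒦, l_n]_RN. -/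

import Mathlib

open Finset

section Framework

variable {V : Type*} [AddCommGroup V] [Module ℝ V]

/-- The Koszul sign `ε(σ)` of a permutation `σ` acting on homogeneous elements whose
degrees are given by `d`. -/
def koszulSign {n : ℕ} (d : Fin n → ℤ) (σ : Equiv.Perm (Fin n)) : ℤ :=
  ∏ p ∈ Finset.univ.filter (fun p : Fin n × Fin n => p.1 < p.2 ∧ σ p.2 < σ p.1),
    (-1 : ℤ) ^ (d (σ p.1) * d (σ p.2)).natAbs

/-- The `(k, n-k)`-unshuffles: permutations of `Fin n` which are increasing on the
first `k` indices and on the remaining ones. -/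
def unshuffles (k n : ℕ) : Finset (Equiv.Perm (Fin n)) :=
  Finset.univ.filter (fun σ =>
    (∀ i j : Fin n, i < j → (j : ℕ) < k → σ i < σ j) ∧
    (∀ i j : Fin n, i < j → k ≤ (i : ℕ) → σ i < σ j))

/-- A (raw) vector valued `k`-form on the graded vector space with grading `𝒢`:
it assigns, to homogeneous elements of degrees `d 0, …, d (k-1)`, an element of `V`. -/
abbrev GForm (𝒢 : ℤ → Submodule ℝ V) (k : ℕ) : Type _ :=
  (d : Fin k → ℤ) → ((i : Fin k) → 𝒢 (d i)) → V

/-- Transport of a vector valued form along an equality of arities. -/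
def castForm {𝒢 : ℤ → Submodule ℝ V} {m n : ℕ} (h : m = n) (K : GForm 𝒢 m) : GForm 𝒢 n :=
  h ▸ K

variable (𝒢 : ℤ → Submodule ℝ V)

/-- Projection on the homogeneous component of degree `i`. -/
def prj [DirectSum.Decomposition 𝒢] (i : ℤ) (v : V) : 𝒢 i :=
  DirectSum.decompose 𝒢 v i

/-- Insertion of a `k`-form `K` of degree `δK` into an `(l+1)`-form `L`:
`ι_K L (X_1,…,X_{k+l}) = Σ_{σ ∈ Sh(k,l)} ε(σ) L(K(X_{σ(1)},…,X_{σ(k)}), X_{σ(k+1)},…)`. -/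
def insertPos [DirectSum.Decomposition 𝒢] {k l : ℕ} (δK : ℤ) (K : GForm 𝒢 k)
    (L : GForm 𝒢 (l + 1)) : GForm 𝒢 (k + l) := fun d x =>
  ∑ σ ∈ unshuffles k (k + l),
    koszulSign d σ •
      L (Fin.cons ((∑ i : Fin k, d (σ (Fin.castAdd l i))) + δK)
          (fun j : Fin l => d (σ (Fin.natAdd k j))))
        (Fin.cons
          (prj 𝒢 ((∑ i : Fin k, d (σ (Fin.castAdd l i))) + δK)
            (K (fun i => d (σ (Fin.castAdd l i))) (fun i => x (σ (Fin.castAdd l i)))))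
          (fun j : Fin l => x (σ (Fin.natAdd k j))))

/-- Insertion operator `ι_K L` of a `k`-form of degree `δK` into an `l`-form. -/
def insertionOp [DirectSum.Decomposition 𝒢] {k l : ℕ} (δK : ℤ) (K : GForm 𝒢 k) :
    GForm 𝒢 l → GForm 𝒢 (k + l - 1) :=
  match l with
  | 0 => fun _ => fun _ _ => 0
  | _ + 1 => fun L => insertPos 𝒢 δK K L

/-- A formal sum of vector valued forms of all arities. -/
abbrev MultiForm : Type _ := (k : ℕ) → GForm 𝒢 k

/-- A single `k`-form seen as a formal sum concentrated in arity `k`. -/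
def singleF (k : ℕ) (K : GForm 𝒢 k) : MultiForm 𝒢 :=
  fun n => if h : n = k then castForm h.symm K else 0

/-- The Richardson–Nijenhuis bracket `[K,L] = ι_K L - (-1)^{K̄ L̄} ι_L K` of formal
sums of forms `K` (of degree `δK`) and `L` (of degree `δL`), computed aritywise. -/
def rnBracketM [DirectSum.Decomposition 𝒢] (δK δL : ℤ) (K L : MultiForm 𝒢) : MultiForm 𝒢 :=
  fun n =>
    (∑ p ∈ (Finset.range (n + 2)).attach,
      castForm (by have := Finset.mem_range.mp p.2; omega)
        (insertionOp 𝒢 δK (K p.1) (L (n + 1 - p.1))))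
    - ((-1 : ℤ) ^ (δK * δL).natAbs) •
      (∑ p ∈ (Finset.range (n + 2)).attach,
        castForm (by have := Finset.mem_range.mp p.2; omega)
          (insertionOp 𝒢 δL (L p.1) (K (n + 1 - p.1))))

/-- `K` is a graded symmetric vector valued `k`-form of degree `δ`. -/
structure IsSymFormOfDeg {k : ℕ} (δ : ℤ) (K : GForm 𝒢 k) : Prop where
  mem_grading : ∀ (d : Fin k → ℤ) (x : (i : Fin k) → 𝒢 (d i)), K d x ∈ 𝒢 ((∑ i, d i) + δ)
  map_add : ∀ (d : Fin k → ℤ) (x : (i : Fin k) → 𝒢 (d i)) (i : Fin k) (a b : 𝒢 (d i)),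
    K d (Function.update x i (a + b)) = K d (Function.update x i a) + K d (Function.update x i b)
  map_smul : ∀ (d : Fin k → ℤ) (x : (i : Fin k) → 𝒢 (d i)) (i : Fin k) (c : ℝ) (a : 𝒢 (d i)),
    K d (Function.update x i (c • a)) = c • K d (Function.update x i a)
  symm : ∀ (d : Fin k → ℤ) (σ : Equiv.Perm (Fin k)) (x : (i : Fin k) → 𝒢 (d i)),
    K (d ∘ σ) (fun i => x (σ i)) = koszulSign d σ • K d x

/-- The `L_∞` identities for a family `(l_i)` of symmetric vector valued forms of degree 1:
for each `n`, `Σ_{i+j=n+1} Σ_{σ ∈ Sh(i,j-1)} ε(σ) l_j (l_i (X_σ(1),…), X_…) = 0`. -/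
def LInftyIdentity [DirectSum.Decomposition 𝒢] (l : MultiForm 𝒢) : Prop :=
  ∀ n : ℕ,
    (∑ p ∈ (Finset.range (n + 2)).attach,
      castForm (by have := Finset.mem_range.mp p.2; omega)
        (insertionOp 𝒢 1 (l p.1) (l (n + 1 - p.1)))) = (0 : GForm 𝒢 n)

end Framework

section Gerstenhaber

variable {V : Type*} [AddCommGroup V] [Module ℝ V]

/-- A Gerstenhaber algebra structure on a graded vector space `(V, 𝒜)`: a graded
commutative associative product `wedge` together with a graded Lie bracket on the
shifted space which is a degree `i` derivation in each argument. -/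
structure Gerstenhaber (𝒜 : ℤ → Submodule ℝ V) : Type _ where
  wedge : V →ₗ[ℝ] V →ₗ[ℝ] V
  bracket : V →ₗ[ℝ] V →ₗ[ℝ] V
  wedge_mem : ∀ (i j : ℤ) (x y : V), x ∈ 𝒜 i → y ∈ 𝒜 j → wedge x y ∈ 𝒜 (i + j)
  bracket_mem : ∀ (i j : ℤ) (x y : V), x ∈ 𝒜 i → y ∈ 𝒜 j → bracket x y ∈ 𝒜 (i + j - 1)
  wedge_assoc : ∀ x y z, wedge (wedge x y) z = wedge x (wedge y z)
  wedge_comm : ∀ (i j : ℤ) (x y : V), x ∈ 𝒜 i → y ∈ 𝒜 j →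
    wedge x y = ((-1 : ℤ) ^ (i * j).natAbs) • wedge y x
  bracket_antisymm : ∀ (i j : ℤ) (x y : V), x ∈ 𝒜 i → y ∈ 𝒜 j →
    bracket x y = -(((-1 : ℤ) ^ ((i - 1) * (j - 1)).natAbs) • bracket y x)
  jacobi : ∀ (i j : ℤ) (x y z : V), x ∈ 𝒜 i → y ∈ 𝒜 j →
    bracket x (bracket y z) = bracket (bracket x y) z
      + ((-1 : ℤ) ^ ((i - 1) * (j - 1)).natAbs) • bracket y (bracket x z)
  leibniz : ∀ (i j : ℤ) (x y z : V), x ∈ 𝒜 i → y ∈ 𝒜 j →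
    bracket x (wedge y z) = wedge (bracket x y) z
      + ((-1 : ℤ) ^ ((i - 1) * j).natAbs) • wedge y (bracket x z)

variable {𝒜 : ℤ → Submodule ℝ V}

/-- The grading of the graded vector space `E` with `E_{-k} := A^k`. -/
abbrev negG (𝒜 : ℤ → Submodule ℝ V) : ℤ → Submodule ℝ V := fun i => 𝒜 (-i)

/-- Iterated wedge product of `k+1` elements. -/
def wedgeAll (G : Gerstenhaber 𝒜) : {k : ℕ} → (Fin (k + 1) → V) → V
  | 0, x => x 0
  | _ + 1, x => G.wedge (x 0) (wedgeAll G (fun i => x i.succ))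

/-- The symmetric vector valued `k`-form `𝒩_k (P_1, …, P_k) := P_1 ∧ ⋯ ∧ P_k`. -/
def mathcalN (G : Gerstenhaber 𝒜) (𝒢 : ℤ → Submodule ℝ V) : (k : ℕ) → GForm 𝒢 k
  | 0 => fun _ _ => 0
  | _ + 1 => fun _ x => wedgeAll G (fun i => (x i : V))

/-- The symmetric vector valued 2-form `l_2 (P_1, P_2) := (-1)^{|P_1|} [P_1, P_2]`. -/
def l2G (G : Gerstenhaber 𝒜) (𝒢 : ℤ → Submodule ℝ V) : GForm 𝒢 2 :=
  fun d x => ((-1 : ℤ) ^ (d 0).natAbs) • G.bracket (x 0) (x 1)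

/-- The family `l_1 := 0`, `l_2`, and `l_i := ι_{l_2} 𝒩_{i-1}` for `i > 2`. -/
def lFormsG (G : Gerstenhaber 𝒜) (𝒢 : ℤ → Submodule ℝ V) [DirectSum.Decomposition 𝒢] :
    (i : ℕ) → GForm 𝒢 i
  | 0 => 0
  | 1 => 0
  | 2 => l2G G 𝒢
  | i + 3 => castForm (by omega) (insertionOp 𝒢 1 (l2G G 𝒢) (mathcalN G 𝒢 (i + 2)))

end Gerstenhaber

section SignedSplits

/-- The sign `(-1)^a`. -/
def parity (a : ℤ) : ℤ := (-1) ^ a.natAbs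

theorem parity_eq_negOnePow (a : ℤ) : parity a = (a.negOnePow : ℤ) := by
  rcases Int.even_or_odd a with h | h
  · rw [parity, Int.negOnePow_even a h, Even.neg_one_pow (Int.natAbs_even.mpr h)]; rfl
  · rw [parity, Int.negOnePow_odd a h, Odd.neg_one_pow (Int.natAbs_odd.mpr h)]; rfl

theorem parity_add (a b : ℤ) : parity (a + b) = parity a * parity b := by
  simp [parity_eq_negOnePow, Int.negOnePow_add]

@[simp] theorem parity_zero : parity 0 = 1 := rfl

theorem parity_mul_self (a : ℤ) : parity a * parity a = 1 := by
  simp [parity, ← pow_add, ← two_mul]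

theorem parity_eq_of_sub_eq {a b : ℤ} (c : ℤ) (h : a - b = 2 * c) : parity a = parity b := by
  obtain rfl : a = b + (c + c) := by linarith
  rw [parity_add, parity_add c, parity_mul_self, mul_one]

variable {V : Type*}

/-- The total degree of a list of elements with prescribed degrees. -/
def listDeg (L : List (ℤ × V)) : ℤ := (L.map Prod.fst).sum

@[simp] theorem listDeg_nil : listDeg ([] : List (ℤ × V)) = 0 := rfl

@[simp] theorem listDeg_cons (a : ℤ × V) (L : List (ℤ × V)) :
    listDeg (a :: L) = a.1 + listDeg L := by simp [listDeg]

theorem listDeg_append (L L' : List (ℤ × V)) :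
    listDeg (L ++ L') = listDeg L + listDeg L' := by simp [listDeg]

theorem listDeg_perm {L L' : List (ℤ × V)} (h : L.Perm L') : listDeg L = listDeg L' :=
  (h.map _).sum_eq

variable [AddCommGroup V]

/-- The sum, with Koszul signs, of `F S T` over all ways of splitting a list into a pair of
complementary sublists. -/
def splitSum : List (ℤ × V) → (List (ℤ × V) → List (ℤ × V) → V) → V
  | [], F => F [] []
  | a :: L, F => splitSum L (fun S T => F (a :: S) T) +
      splitSum L (fun S T => parity (a.1 * listDeg S) • F S (a :: T))

theorem splitSum_congr {L : List (ℤ × V)} {F F' : List (ℤ × V) → List (ℤ × V) → V}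
    (h : ∀ S T, (S ++ T).Perm L → F S T = F' S T) : splitSum L F = splitSum L F' := by
  induction L generalizing F F' with
  | nil => exact h _ _ (List.Perm.refl _)
  | cons a L ih =>
    rw [splitSum, splitSum]
    congr 1
    · exact ih fun S T hp => h _ _ (by simpa using hp)
    · exact ih fun S T hp => by rw [h _ _ (List.perm_middle.trans (hp.cons a))]

theorem splitSum_add (L : List (ℤ × V)) (F F' : List (ℤ × V) → List (ℤ × V) → V) :
    splitSum L (fun S T => F S T + F' S T) = splitSum L F + splitSum L F' := by
  induction L generalizing F F' with
  | nil => rfl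
  | cons a L ih =>
    simp only [splitSum, smul_add, ih]
    abel

theorem splitSum_zero (L : List (ℤ × V)) : splitSum L (fun _ _ => (0 : V)) = 0 := by
  induction L with
  | nil => rfl
  | cons a L ih => simp only [splitSum, smul_zero, ih, add_zero]

theorem map_splitSum (f : V →+ V) (L : List (ℤ × V))
    (F : List (ℤ × V) → List (ℤ × V) → V) :
    f (splitSum L F) = splitSum L (fun S T => f (F S T)) := by
  induction L generalizing F with
  | nil => rfl
  | cons a L ih => simp only [splitSum, map_add, map_zsmul, ih]

theorem zsmul_splitSum (c : ℤ) (L : List (ℤ × V)) (F : List (ℤ × V) → List (ℤ × V) → V) :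
    c • splitSum L F = splitSum L (fun S T => c • F S T) :=
  map_splitSum (DistribSMul.toAddMonoidHom V c) L F

theorem nsmul_splitSum (c : ℕ) (L : List (ℤ × V)) (F : List (ℤ × V) → List (ℤ × V) → V) :
    c • splitSum L F = splitSum L (fun S T => c • F S T) :=
  map_splitSum (DistribSMul.toAddMonoidHom V c) L F

theorem smul_splitSum [Module ℝ V] (c : ℝ) (L : List (ℤ × V)) (F : List (ℤ × V) → List (ℤ × V) → V) :
    c • splitSum L F = splitSum L (fun S T => c • F S T) :=
  map_splitSum (DistribSMul.toAddMonoidHom V c) L F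

theorem splitSum_mem [Module ℝ V] (W : Submodule ℝ V) {L : List (ℤ × V)}
    {F : List (ℤ × V) → List (ℤ × V) → V} (h : ∀ S T, (S ++ T).Perm L → F S T ∈ W) :
    splitSum L F ∈ W := by
  induction L generalizing F with
  | nil => exact h _ _ (List.Perm.refl _)
  | cons a L ih =>
    refine W.add_mem (ih fun S T hp => h _ _ (by simpa using hp)) (ih fun S T hp => ?_)
    exact zsmul_mem (h _ _ (List.perm_middle.trans (hp.cons a))) _

theorem splitSum_comm (L L' : List (ℤ × V))
    (F : List (ℤ × V) → List (ℤ × V) → List (ℤ × V) → List (ℤ × V) → V) :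
    splitSum L (fun A B => splitSum L' (fun S T => F A B S T)) =
      splitSum L' (fun S T => splitSum L (fun A B => F A B S T)) := by
  induction L generalizing F with
  | nil => rfl
  | cons a L ih => simp only [splitSum, splitSum_add, zsmul_splitSum, ih]

theorem splitSum_coassoc (L : List (ℤ × V))
    (F : List (ℤ × V) → List (ℤ × V) → List (ℤ × V) → V) :
    splitSum L (fun A B => splitSum B (fun S T => F A S T)) =
      splitSum L (fun C T => splitSum C (fun A S => F A S T)) := by
  induction L generalizing F with
  | nil => rfl
  | cons a L ih =>
    simp only [splitSum, splitSum_add, smul_add, zsmul_splitSum, ih, ← add_assoc]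
    congr 1
    refine splitSum_congr fun C T _ => splitSum_congr fun A S h => ?_
    rw [smul_smul, ← parity_add, ← listDeg_perm h, listDeg_append, mul_add]

theorem splitSum_swap (L : List (ℤ × V)) (F : List (ℤ × V) → List (ℤ × V) → V) :
    splitSum L F = splitSum L (fun S T => parity (listDeg S * listDeg T) • F T S) := by
  induction L generalizing F with
  | nil => simp [splitSum]
  | cons a L ih =>
    rw [splitSum, splitSum, add_comm, ih, ih (fun S T => F (a :: S) T)]
    congr 1 <;>
    · refine splitSum_congr fun S T _ => ?_
      simp only [smul_smul, ← parity_add, listDeg_cons]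
      congr 1
      first
      | exact parity_eq_of_sub_eq 0 (by ring1)
      | exact parity_eq_of_sub_eq (-(a.1 * listDeg T)) (by ring1)
      | exact parity_eq_of_sub_eq (-(a.1 * listDeg S)) (by ring1)

/-- Exchange of the first two blocks in a threefold splitting. -/
theorem splitSum_exchange (L : List (ℤ × V))
    (F : List (ℤ × V) → List (ℤ × V) → List (ℤ × V) → V) :
    splitSum L (fun A B => splitSum B (fun S T => F A S T)) =
      splitSum L (fun A B => splitSum B (fun S T =>
        parity (listDeg A * listDeg S) • F S A T)) := by
  rw [splitSum_coassoc, splitSum_coassoc]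
  exact splitSum_congr fun C T _ => splitSum_swap C _

theorem splitSum_nil_left (L : List (ℤ × V)) (F : List (ℤ × V) → List (ℤ × V) → V)
    (hF : ∀ S T, S ≠ [] → F S T = 0) : splitSum L F = F [] L := by
  induction L generalizing F with
  | nil => rfl
  | cons a L ih =>
    rw [splitSum, splitSum_congr (F' := fun _ _ => 0) fun S T _ => hF _ _ (by simp),
      splitSum_zero, zero_add, ih _ fun S T h => by rw [hF _ _ h, smul_zero]]
    simp

end SignedSplits

section ListForms

variable {V : Type*} [AddCommGroup V] [Module ℝ V] {𝒜 : ℤ → Submodule ℝ V}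

/-- Every entry of the list is homogeneous of the prescribed degree. -/
def IsHomog (𝒢 : ℤ → Submodule ℝ V) (L : List (ℤ × V)) : Prop := ∀ p ∈ L, p.2 ∈ 𝒢 p.1

theorem isHomog_cons {𝒢 : ℤ → Submodule ℝ V} {a : ℤ × V} {L : List (ℤ × V)} :
    IsHomog 𝒢 (a :: L) ↔ a.2 ∈ 𝒢 a.1 ∧ IsHomog 𝒢 L := List.forall_mem_cons

theorem isHomog_append {𝒢 : ℤ → Submodule ℝ V} {L L' : List (ℤ × V)} :
    IsHomog 𝒢 (L ++ L') ↔ IsHomog 𝒢 L ∧ IsHomog 𝒢 L' := List.forall_mem_append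

theorem IsHomog.of_perm {𝒢 : ℤ → Submodule ℝ V} {L L' : List (ℤ × V)} (h : IsHomog 𝒢 L)
    (hp : L'.Perm L) : IsHomog 𝒢 L' := fun p hm => h p (hp.mem_iff.mp hm)

theorem IsHomog.split {𝒢 : ℤ → Submodule ℝ V} {L S T : List (ℤ × V)} (h : IsHomog 𝒢 L)
    (hp : (S ++ T).Perm L) : IsHomog 𝒢 S ∧ IsHomog 𝒢 T := isHomog_append.mp (h.of_perm hp)

namespace Gerstenhaber

variable (G : Gerstenhaber 𝒜)

/-- Right multiplication `v ∧ p₁ ∧ ⋯ ∧ pₖ` by the entries of a list. -/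
def mulList (v : V) : List (ℤ × V) → V
  | [] => v
  | p :: T => mulList (G.wedge v p.2) T

/-- The product of the entries of a list, zero on the empty list. -/
def listProd : List (ℤ × V) → V
  | [] => 0
  | p :: T => G.mulList p.2 T

/-- The bracket `(-1)^{|a|} [a, b]`. -/
def listL2 : List (ℤ × V) → List (ℤ × V) → V
  | [a], [b] => parity a.1 • G.bracket a.2 b.2
  | _, _ => 0

/-- The same bracket on lists of length two. -/
def listPair : List (ℤ × V) → V
  | [a, b] => G.listL2 [a] [b]
  | _ => 0

/-- The form `ι_{l₂} 𝒩` on lists. -/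
def listL (L : List (ℤ × V)) : V := splitSum L (fun S T => G.mulList (G.listPair S) T)

theorem mulList_add (v w : V) (T : List (ℤ × V)) :
    G.mulList (v + w) T = G.mulList v T + G.mulList w T := by
  induction T generalizing v w with
  | nil => rfl
  | cons a T ih => simp [mulList, ih]

/-- `mulList` as a linear map. -/
def mulListHom (T : List (ℤ × V)) : V →+ V :=
  AddMonoidHom.mk' (fun v => G.mulList v T) (fun v w => G.mulList_add v w T)

@[simp] theorem mulList_zero (T : List (ℤ × V)) : G.mulList 0 T = 0 :=
  (G.mulListHom T).map_zero

theorem mulList_zsmul (c : ℤ) (v : V) (T : List (ℤ × V)) :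
    G.mulList (c • v) T = c • G.mulList v T :=
  map_zsmul (G.mulListHom T) c v

theorem mulList_smul (c : ℝ) (v : V) (T : List (ℤ × V)) :
    G.mulList (c • v) T = c • G.mulList v T := by
  induction T generalizing v with
  | nil => rfl
  | cons a T ih => simp [mulList, ih]

theorem mulList_splitSum (L T : List (ℤ × V)) (F : List (ℤ × V) → List (ℤ × V) → V) :
    G.mulList (splitSum L F) T = splitSum L (fun A B => G.mulList (F A B) T) :=
  map_splitSum (G.mulListHom T) L F

theorem wedge_mulList (v w : V) (T : List (ℤ × V)) :
    G.wedge v (G.mulList w T) = G.mulList (G.wedge v w) T := by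
  induction T generalizing w with
  | nil => rfl
  | cons a T ih => rw [mulList, mulList, ih, G.wedge_assoc]

theorem wedge_listProd (v : V) {T : List (ℤ × V)} (hT : T ≠ []) :
    G.wedge v (G.listProd T) = G.mulList v T := by
  cases T with
  | nil => exact absurd rfl hT
  | cons a T => rw [listProd, wedge_mulList, mulList]

theorem wedge_comm_neg {i j : ℤ} {x y : V} (hx : x ∈ negG 𝒜 i) (hy : y ∈ negG 𝒜 j) :
    G.wedge x y = parity (i * j) • G.wedge y x := by
  rw [G.wedge_comm (-i) (-j) x y hx hy, neg_mul_neg, parity]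

theorem wedge_mem_neg {i j : ℤ} {x y : V} (hx : x ∈ negG 𝒜 i) (hy : y ∈ negG 𝒜 j) :
    G.wedge x y ∈ negG 𝒜 (i + j) := by
  have := G.wedge_mem _ _ x y hx hy
  rwa [negG, neg_add]

theorem mulList_mem {d : ℤ} {v : V} (hv : v ∈ negG 𝒜 d) {T : List (ℤ × V)}
    (hT : IsHomog (negG 𝒜) T) : G.mulList v T ∈ negG 𝒜 (d + listDeg T) := by
  induction T generalizing v d with
  | nil => simpa [mulList] using hv
  | cons a T ih =>
    rw [isHomog_cons] at hT
    rw [mulList, listDeg_cons, ← add_assoc]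
    exact ih (G.wedge_mem_neg hv hT.1) hT.2

theorem listProd_mem {T : List (ℤ × V)} (hT : IsHomog (negG 𝒜) T) :
    G.listProd T ∈ negG 𝒜 (listDeg T) := by
  cases T with
  | nil => exact zero_mem _
  | cons a T =>
    rw [isHomog_cons] at hT
    exact G.mulList_mem hT.1 hT.2

theorem wedge_wedge_swap (v : V) {i j : ℤ} {x y : V} (hx : x ∈ negG 𝒜 i)
    (hy : y ∈ negG 𝒜 j) :
    G.wedge (G.wedge v x) y = parity (i * j) • G.wedge (G.wedge v y) x := by
  rw [G.wedge_assoc, G.wedge_comm_neg hx hy, map_zsmul, G.wedge_assoc]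

theorem mulList_wedge (v : V) {a : ℤ × V} (ha : a.2 ∈ negG 𝒜 a.1) {T : List (ℤ × V)}
    (hT : IsHomog (negG 𝒜) T) :
    G.mulList (G.wedge v a.2) T =
      parity (a.1 * listDeg T) • G.wedge (G.mulList v T) a.2 := by
  induction T generalizing v with
  | nil => simp [mulList]
  | cons b T ih =>
    rw [isHomog_cons] at hT
    rw [mulList, G.wedge_wedge_swap v ha hT.1, mulList_zsmul, ih _ hT.2, smul_smul,
      ← parity_add, mulList, listDeg_cons, mul_add]

theorem wedge_mulList_right (v : V) {a : ℤ × V} (ha : a.2 ∈ negG 𝒜 a.1) {T : List (ℤ × V)}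
    (hT : IsHomog (negG 𝒜) T) :
    G.wedge (G.mulList v T) a.2 =
      parity (a.1 * listDeg T) • G.mulList v (a :: T) := by
  rw [mulList, G.mulList_wedge v ha hT, smul_smul, parity_mul_self, one_smul]

/-- Splitting off `i` factors of a product in all possible ways. -/
theorem splitSum_mulList_mulList (v : V) (i : ℕ) {L : List (ℤ × V)}
    (hL : IsHomog (negG 𝒜) L) :
    splitSum L (fun S T => if S.length = i then G.mulList (G.mulList v S) T else 0) =
      L.length.choose i • G.mulList v L := by
  induction L generalizing v i with
  | nil => cases i <;> simp [splitSum, mulList]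
  | cons a L ih =>
    rw [isHomog_cons] at hL
    have h2 : splitSum L (fun S T => parity (a.1 * listDeg S) •
        if S.length = i then G.mulList (G.mulList v S) (a :: T) else 0) =
        L.length.choose i • G.mulList v (a :: L) := by
      rw [mulList, ← ih _ _ hL.2]
      refine splitSum_congr fun S T hp => ?_
      split_ifs
      · rw [G.mulList_wedge v hL.1 (hL.2.split hp).1, mulList_zsmul]; rfl
      · simp
    rw [splitSum, h2]
    cases i with
    | zero => simp [splitSum_zero]
    | succ i =>
      simp only [List.length_cons, add_left_inj, mulList]
      rw [ih _ _ hL.2, Nat.choose_succ_succ, add_smul]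

theorem bracket_mem_neg {i j : ℤ} {x y : V} (hx : x ∈ negG 𝒜 i) (hy : y ∈ negG 𝒜 j) :
    G.bracket x y ∈ negG 𝒜 (i + j + 1) := by
  have := G.bracket_mem _ _ x y hx hy
  rw [negG]
  convert this using 2
  ring

theorem bracket_antisymm_neg {i j : ℤ} {x y : V} (hx : x ∈ negG 𝒜 i) (hy : y ∈ negG 𝒜 j) :
    G.bracket x y = -(parity ((i + 1) * (j + 1)) • G.bracket y x) := by
  rw [G.bracket_antisymm (-i) (-j) x y hx hy]
  rw [show (-i - 1) * (-j - 1) = (i + 1) * (j + 1) by ring, parity]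

theorem bracket_wedge_neg {i j : ℤ} {x y : V} (z : V) (hx : x ∈ negG 𝒜 i)
    (hy : y ∈ negG 𝒜 j) :
    G.bracket x (G.wedge y z) =
      G.wedge (G.bracket x y) z + parity ((i + 1) * j) • G.wedge y (G.bracket x z) := by
  rw [G.leibniz (-i) (-j) x y z hx hy]
  rw [show (-i - 1) * -j = (i + 1) * j by ring, parity]

theorem listL2_symm {a b : ℤ × V} (ha : a.2 ∈ negG 𝒜 a.1) (hb : b.2 ∈ negG 𝒜 b.1) :
    G.listL2 [a] [b] = parity (a.1 * b.1) • G.listL2 [b] [a] := by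
  rw [listL2, listL2, G.bracket_antisymm_neg ha hb, smul_neg, smul_smul, smul_smul,
    ← neg_smul, ← parity_add, ← parity_add, ← neg_one_mul]
  rw [show (-1 : ℤ) = parity 1 from rfl, ← parity_add]
  congr 1
  exact parity_eq_of_sub_eq (a.1 + 1) (by ring)

theorem listL2_mem {a b : ℤ × V} (ha : a.2 ∈ negG 𝒜 a.1) (hb : b.2 ∈ negG 𝒜 b.1) :
    G.listL2 [a] [b] ∈ negG 𝒜 (a.1 + b.1 + 1) :=
  zsmul_mem (G.bracket_mem_neg ha hb) _

/-- `l₂` is a graded derivation of the product in its first argument. -/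
theorem listL2_wedge {i j : ℤ} {x y : V} (hx : x ∈ negG 𝒜 i) (hy : y ∈ negG 𝒜 j)
    {c : ℤ × V} (hc : c.2 ∈ negG 𝒜 c.1) :
    G.listL2 [(i + j, G.wedge x y)] [c] =
      parity (c.1 * j) • G.wedge (G.listL2 [(i, x)] [c]) y +
        parity (i * (j + c.1)) • G.wedge (G.listL2 [(j, y)] [c]) x := by
  have h1 : G.listL2 [c] [(i + j, G.wedge x y)] =
      G.wedge (G.listL2 [c] [(i, x)]) y +
        parity (i * j) • G.wedge (G.listL2 [c] [(j, y)]) x := by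
    simp only [listL2]
    rw [G.bracket_wedge_neg y hc hx, G.wedge_comm_neg hx (G.bracket_mem_neg hc hy), smul_add]
    simp only [smul_smul, map_zsmul, LinearMap.smul_apply, ← parity_add]
    congr 2
    exact parity_eq_of_sub_eq (i * (c.1 + 1)) (by ring)
  rw [G.listL2_symm (a := (i + j, G.wedge x y)) (G.wedge_mem_neg hx hy) hc, h1,
    G.listL2_symm (b := (i, x)) hc hx, G.listL2_symm (b := (j, y)) hc hy]
  simp only [smul_add, smul_smul, map_zsmul, LinearMap.smul_apply, ← parity_add]
  congr 2
  · exact parity_eq_of_sub_eq (c.1 * i) (by ring)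
  · exact parity_eq_of_sub_eq (c.1 * j) (by ring)

/-- `l₂` of a product, as a sum over the factors. -/
theorem listL2_listProd {U : List (ℤ × V)} (hU : IsHomog (negG 𝒜) U)
    {c : ℤ × V} (hc : c.2 ∈ negG 𝒜 c.1) :
    G.listL2 [(listDeg U, G.listProd U)] [c] = splitSum U (fun S T =>
      parity (c.1 * listDeg T) • G.mulList (G.listL2 S [c]) T) := by
  induction U with
  | nil => simp [listL2, listProd, splitSum]
  | cons a U ih =>
    rw [isHomog_cons] at hU
    have h1 : splitSum U (fun S T => parity (c.1 * listDeg T) •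
        G.mulList (G.listL2 (a :: S) [c]) T) =
        parity (c.1 * listDeg U) • G.mulList (G.listL2 [a] [c]) U :=
      splitSum_nil_left _ _ fun S T hS => by
        cases S with
        | nil => exact absurd rfl hS
        | cons b S => simp [listL2]
    rcases eq_or_ne U [] with rfl | hne
    · simp [splitSum, listProd, mulList, listL2]
    rw [splitSum, h1, show G.listProd (a :: U) = G.wedge a.2 (G.listProd U) from
      (G.wedge_listProd _ hne).symm, listDeg_cons,
      G.listL2_wedge hU.1 (G.listProd_mem hU.2) hc, ih hU.2, G.wedge_listProd _ hne]
    congr 1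
    rw [show ∀ v, G.wedge v a.2 = G.mulList v [a] from fun _ => rfl, mulList_splitSum,
      zsmul_splitSum]
    refine splitSum_congr fun S T hp => ?_
    have hT := (hU.2.split hp).2
    rw [mulList_zsmul, mulList, mulList, G.wedge_mulList_right _ hU.1 hT]
    simp only [smul_smul, ← parity_add, listDeg_cons, ← listDeg_perm hp, listDeg_append]
    congr 1
    exact parity_eq_of_sub_eq (a.1 * listDeg T) (by ring)

theorem listPair_cons (a : ℤ × V) (S : List (ℤ × V)) :
    G.listPair (a :: S) = G.listL2 [a] S := by
  match S with
  | [] => rfl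
  | [_] => rfl
  | _ :: _ :: _ => rfl

theorem listPair_eq_zero {S : List (ℤ × V)} (h : S.length ≠ 2) : G.listPair S = 0 := by
  match S, h with
  | [], _ => rfl
  | [_], _ => rfl
  | [_, _], h => exact absurd rfl h
  | _ :: _ :: _ :: _, _ => rfl

theorem listL2_eq_zero {S T : List (ℤ × V)} (h : S.length ≠ 1 ∨ T.length ≠ 1) :
    G.listL2 S T = 0 := by
  match S, T, h with
  | [], _, _ => rfl
  | [_], [], _ => rfl
  | [_], [_], h => simp at h
  | [_], _ :: _ :: _, _ => rfl
  | _ :: _ :: _, _, _ => rfl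

theorem listPair_mem {S : List (ℤ × V)} (hS : IsHomog (negG 𝒜) S) :
    G.listPair S ∈ negG 𝒜 (listDeg S + 1) := by
  match S, hS with
  | [], _ => exact zero_mem _
  | [_], _ => exact zero_mem _
  | [a, b], h =>
    simp only [isHomog_cons] at h
    simpa [listPair, add_assoc] using G.listL2_mem h.1 h.2.1
  | _ :: _ :: _ :: _, _ => exact zero_mem _

theorem listL_mem {L : List (ℤ × V)} (hL : IsHomog (negG 𝒜) L) :
    G.listL L ∈ negG 𝒜 (listDeg L + 1) := by
  refine splitSum_mem _ fun S T hp => ?_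
  have h := hL.split hp
  have := G.mulList_mem (G.listPair_mem h.1) h.2
  rwa [add_right_comm, ← listDeg_append, listDeg_perm hp] at this

theorem listL_eq_zero {L : List (ℤ × V)} (h : L.length < 2) : G.listL L = 0 := by
  rw [listL, splitSum_congr (F' := fun _ _ => 0), splitSum_zero]
  intro S T hp
  have := hp.length_eq
  rw [List.length_append] at this
  rw [G.listPair_eq_zero (by omega), mulList_zero]

theorem listL_cons (y : ℤ × V) (Z : List (ℤ × V)) :
    G.listL (y :: Z) = splitSum Z (fun S T => G.mulList (G.listL2 [y] S) T) +
      splitSum Z (fun S T =>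
        parity (y.1 * listDeg S) • G.mulList (G.listPair S) (y :: T)) := by
  rw [listL, splitSum]
  simp only [listPair_cons]

theorem listL_cons_smul (d : ℤ) (c : ℝ) (v : V) (Z : List (ℤ × V)) :
    G.listL ((d, c • v) :: Z) = c • G.listL ((d, v) :: Z) := by
  rw [listL_cons, listL_cons, smul_add, smul_splitSum, smul_splitSum]
  congr 1
  · refine splitSum_congr fun S T _ => ?_
    rw [← mulList_smul]
    congr 1
    match S with
    | [] => simp [listL2]
    | [b] =>
      simp only [listL2, map_smul, LinearMap.smul_apply]
      exact smul_comm _ _ _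
    | _ :: _ :: _ => simp [listL2]
  · refine splitSum_congr fun S T _ => ?_
    rw [mulList, mulList, map_smul, mulList_smul, smul_comm]

theorem splitSum_listL2 {C : List (ℤ × V)} (hC : IsHomog (negG 𝒜) C) :
    splitSum C (fun S T => G.listL2 S T) = 2 • G.listPair C := by
  by_cases h : C.length = 2
  · obtain ⟨a, b, rfl⟩ := List.length_eq_two.mp h
    simp only [isHomog_cons] at hC
    have := G.listL2_symm hC.1 hC.2.1
    simp only [splitSum, listPair, two_smul, G.listL2_eq_zero (S := []) (Or.inl (by simp)),
      G.listL2_eq_zero (T := []) (Or.inr (by simp))]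
    conv_rhs => enter [2]; rw [this]
    simp
  · rw [G.listPair_eq_zero h, smul_zero, splitSum_congr (F' := fun _ _ => 0), splitSum_zero]
    intro S T hp
    have := hp.length_eq
    rw [List.length_append] at this
    exact G.listL2_eq_zero (by omega)

/-- The terms of the insertion of a product into `ι_{l₂} 𝒩` in which the product is not an
argument of `l₂`. -/
theorem splitSum_mulList_listProd {p : ℕ} (hp : 1 ≤ p) {L : List (ℤ × V)}
    (hL : IsHomog (negG 𝒜) L) :
    splitSum L (fun U Z => splitSum Z (fun S T =>
      parity (listDeg U * listDeg S) • if U.length = p then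
        G.mulList (G.listPair S) ((listDeg U, G.listProd U) :: T) else 0)) =
      (L.length - 2).choose p • G.listL L := by
  rw [← splitSum_exchange L (fun S U T => if U.length = p then
        G.mulList (G.listPair S) ((listDeg U, G.listProd U) :: T) else 0), listL,
    nsmul_splitSum]
  refine splitSum_congr fun S B hSB => ?_
  have hB := (hL.split hSB).2
  by_cases hS : S.length = 2
  · have hlen : B.length = L.length - 2 := by
      have := hSB.length_eq
      rw [List.length_append] at this
      omega
    rw [← hlen, ← G.splitSum_mulList_mulList _ p hB]
    refine splitSum_congr fun U T _ => ?_
    split_ifs with hU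
    · rw [mulList, G.wedge_listProd _ (by rintro rfl; simp at hU; omega)]
    · rfl
  · simp [G.listPair_eq_zero hS, splitSum_zero]

/-- The terms of the insertion of a product into `ι_{l₂} 𝒩` in which the product is an
argument of `l₂`. -/
theorem splitSum_listL2_listProd {p : ℕ} {L : List (ℤ × V)}
    (hL : IsHomog (negG 𝒜) L) :
    splitSum L (fun U Z => splitSum Z (fun S T => if U.length = p + 1 then
        G.mulList (G.listL2 [(listDeg U, G.listProd U)] S) T else 0)) =
      (2 * (L.length - 2).choose p) • G.listL L := by
  let F : List (ℤ × V) → List (ℤ × V) → List (ℤ × V) → List (ℤ × V) → V :=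
    fun A S B T => if B.length = p then G.mulList (G.mulList (G.listL2 A S) B) T else 0
  have h1 : splitSum L (fun U Z => splitSum Z (fun S T => if U.length = p + 1 then
        G.mulList (G.listL2 [(listDeg U, G.listProd U)] S) T else 0)) =
      splitSum L (fun U Z => splitSum U (fun A B => splitSum Z (fun S T =>
        parity (listDeg B * listDeg S) • F A S B T))) := by
    refine splitSum_congr fun U Z hUZ => ?_
    rw [splitSum_comm]
    refine splitSum_congr fun S T hST => ?_
    have hU := (hL.split hUZ).1
    have hS := ((hL.split hUZ).2.split hST).1
    by_cases hlen : S.length = 1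
    · obtain ⟨c, rfl⟩ := List.length_eq_one_iff.mp hlen
      rw [isHomog_cons] at hS
      rw [G.listL2_listProd hU hS.1, mulList_splitSum]
      split_ifs with hUp
      · refine splitSum_congr fun A B hAB => ?_
        have hl := hAB.length_eq
        rw [List.length_append] at hl
        by_cases hA : A.length = 1
        · simp only [F]
          rw [if_pos (by omega), mulList_zsmul, mul_comm]
          simp
        · simp [F, G.listL2_eq_zero (S := A) (Or.inl hA)]
      · rw [splitSum_congr (F' := fun _ _ => 0), splitSum_zero]
        intro A B hAB
        have hl := hAB.length_eq
        rw [List.length_append] at hl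
        by_cases hA : A.length = 1
        · simp only [F]
          rw [if_neg (by omega), smul_zero]
        · simp [F, G.listL2_eq_zero (S := A) (Or.inl hA)]
    · simp [F, G.listL2_eq_zero (T := S) (Or.inr hlen), splitSum_zero]
  have h2 : ∀ A B, (A ++ B).Perm L →
      splitSum B (fun C Z => splitSum Z (fun S T =>
        parity (listDeg C * listDeg S) • F A S C T)) =
      splitSum B (fun S Z =>
        (L.length - 2).choose p • G.mulList (G.listL2 A S) Z) := by
    intro A B hAB
    rw [← splitSum_exchange B (fun S C T => F A S C T)]
    refine splitSum_congr fun S Z hSZ => ?_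
    by_cases hlen : A.length ≠ 1 ∨ S.length ≠ 1
    · simp [F, G.listL2_eq_zero hlen, splitSum_zero]
    · have hZ : Z.length = L.length - 2 := by
        have h3 := hAB.length_eq
        have h4 := hSZ.length_eq
        rw [List.length_append] at h3 h4
        omega
      rw [← hZ]
      exact G.splitSum_mulList_mulList _ p ((hL.split hAB).2.split hSZ).2
  rw [h1, ← splitSum_coassoc L (fun A B Z => splitSum Z (fun S T =>
    parity (listDeg B * listDeg S) • F A S B T)), splitSum_congr h2, splitSum_coassoc, listL,
    nsmul_splitSum]
  refine splitSum_congr fun C T hCT => ?_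
  rw [← nsmul_splitSum, ← mulList_splitSum, G.splitSum_listL2 (hL.split hCT).1, mul_comm,
    mul_smul]
  congr 1
  exact map_nsmul (G.mulListHom T) 2 _

/-- Insertion of `𝒩_p` into `ι_{l₂} 𝒩`. -/
theorem splitSum_listL_listProd {p : ℕ} {L : List (ℤ × V)} (hL : IsHomog (negG 𝒜) L) :
    splitSum L (fun U Z => if U.length = p + 1 then
        G.listL ((listDeg U, G.listProd U) :: Z) else 0) =
      (2 * (L.length - 2).choose p + (L.length - 2).choose (p + 1)) • G.listL L := by
  rw [add_smul, ← G.splitSum_mulList_listProd (Nat.le_add_left 1 p) hL,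
    ← G.splitSum_listL2_listProd hL, ← splitSum_add]
  refine splitSum_congr fun U Z _ => ?_
  split_ifs
  · exact G.listL_cons _ _
  · simp [splitSum_zero]

/-- Insertion of the `q`-ary part of `ι_{l₂} 𝒩` into `𝒩`. -/
theorem splitSum_mulList_listL {q : ℕ} {L : List (ℤ × V)} (hL : IsHomog (negG 𝒜) L) :
    splitSum L (fun S T => if S.length = q + 2 then G.mulList (G.listL S) T else 0) =
      (L.length - 2).choose q • G.listL L := by
  have h1 : splitSum L (fun S T =>
        if S.length = q + 2 then G.mulList (G.listL S) T else 0) =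
      splitSum L (fun C T => splitSum C (fun A S => if S.length = q then
        G.mulList (G.mulList (G.listPair A) S) T else 0)) := by
    refine splitSum_congr fun C T _ => ?_
    rw [listL, mulList_splitSum]
    have : ∀ A S : List (ℤ × V), (A ++ S).Perm C → A.length = 2 → (C.length = q + 2 ↔ S.length = q) := by
      intro A S hAS hA
      have := hAS.length_eq
      rw [List.length_append] at this
      omega
    split_ifs with hC
    · refine splitSum_congr fun A S hAS => ?_
      by_cases hA : A.length = 2
      · rw [if_pos ((this A S hAS hA).mp hC)]
      · simp [G.listPair_eq_zero hA]
    · rw [splitSum_congr (F' := fun _ _ => 0), splitSum_zero]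
      intro A S hAS
      by_cases hA : A.length = 2
      · rw [if_neg (mt (this A S hAS hA).mpr hC)]
      · simp [G.listPair_eq_zero hA]
  rw [h1, ← splitSum_coassoc L (fun A S T => if S.length = q then
        G.mulList (G.mulList (G.listPair A) S) T else 0), listL, nsmul_splitSum]
  refine splitSum_congr fun A B hAB => ?_
  by_cases hA : A.length = 2
  · have hB : B.length = L.length - 2 := by
      have := hAB.length_eq
      rw [List.length_append] at this
      omega
    rw [← hB]
    exact G.splitSum_mulList_mulList _ q (hL.split hAB).2
  · simp [G.listPair_eq_zero hA, splitSum_zero]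

/-- The Richardson–Nijenhuis bracket of `𝒩_p` and `l_q`, evaluated on a list. -/
theorem splitSum_bracket {p q : ℕ} (hp : 1 ≤ p) {L : List (ℤ × V)}
    (hL : IsHomog (negG 𝒜) L) (hpq : p + q = L.length + 1) :
    splitSum L (fun U Z => if U.length = p then
        G.listL ((listDeg U, G.listProd U) :: Z) else 0) -
      splitSum L (fun S T => if S.length = q then G.mulList (G.listL S) T else 0) =
      (L.length - 1).choose p • G.listL L := by
  obtain ⟨p, rfl⟩ := Nat.exists_eq_add_of_le' hp
  rw [G.splitSum_listL_listProd hL]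
  by_cases hq : 2 ≤ q
  · obtain ⟨q, rfl⟩ := Nat.exists_eq_add_of_le' hq
    obtain ⟨m, hm⟩ : ∃ m, L.length = m + 2 := ⟨p + q, by omega⟩
    rw [G.splitSum_mulList_listL hL, hm, sub_eq_iff_eq_add, ← add_smul]
    congr 1
    simp only [Nat.add_sub_cancel, show m + 2 - 1 = m + 1 by omega]
    rw [Nat.choose_succ_succ', show m.choose q = m.choose p from
      Nat.choose_symm_of_eq_add (by omega)]
    omega
  · have h0 : splitSum L (fun S T => if S.length = q then G.mulList (G.listL S) T else 0) = 0 := by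
      rw [splitSum_congr (F' := fun _ _ => 0), splitSum_zero]
      intro S T _
      split_ifs with h
      · rw [G.listL_eq_zero (by omega), mulList_zero]
      · rfl
    rw [h0, sub_zero]
    by_cases hlen : L.length < 2
    · rw [G.listL_eq_zero hlen, smul_zero, smul_zero]
    · rw [Nat.choose_eq_zero_of_lt (show L.length - 2 < p by omega),
        Nat.choose_eq_zero_of_lt (show L.length - 2 < p + 1 by omega),
        Nat.choose_eq_zero_of_lt (show L.length - 1 < p + 1 by omega)]

end Gerstenhaber

end ListForms

section Unshuffles

variable {V : Type*}

theorem listDeg_filter_map {n : ℕ} (x : Fin n → ℤ × V) (c : Fin n → Bool) :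
    listDeg (((List.finRange n).filter c).map x) = ∑ i, if c i then (x i).1 else 0 := by
  induction n with
  | zero => simp
  | succ n ih =>
    rw [Fin.sum_univ_succ, List.finRange_succ, List.filter_cons]
    have := ih (fun i => x i.succ) (fun i => c i.succ)
    simp only [← this]
    split_ifs <;> simp [List.filter_map, Function.comp_def]

theorem parity_sum {ι : Type*} (s : Finset ι) (f : ι → ℤ) :
    parity (∑ i ∈ s, f i) = ∏ i ∈ s, parity (f i) := by
  classical
  induction s using Finset.induction_on with
  | empty => rfl
  | insert a s ha ih => rw [Finset.sum_insert ha, Finset.prod_insert ha, parity_add, ih]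

variable [AddCommGroup V]

theorem splitSum_ofFn {n : ℕ} (x : Fin n → ℤ × V) (F : List (ℤ × V) → List (ℤ × V) → V) :
    splitSum (List.ofFn x) F = ∑ c : Fin n → Bool,
      (∏ i, ∏ j, if c i = true ∧ c j = false ∧ j < i then
        parity ((x i).1 * (x j).1) else 1) •
      F (((List.finRange n).filter c).map x)
        (((List.finRange n).filter (fun i => !c i)).map x) := by
  induction n generalizing F with
  | zero => simp [splitSum]
  | succ n ih =>
    rw [List.ofFn_succ, splitSum, ih, ih,
      ← (Fin.consEquiv (fun _ : Fin (n + 1) => Bool)).sum_comp, Fintype.sum_prod_type,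
      Fintype.sum_bool]
    congr 1
    · refine Finset.sum_congr rfl fun c _ => ?_
      simp only [Fin.consEquiv_apply, List.finRange_succ, List.filter_cons, List.filter_map,
        Fin.prod_univ_succ, Fin.cons_zero, Fin.cons_succ]
      simp [Function.comp_def]
    · refine Finset.sum_congr rfl fun c _ => ?_
      simp only [Fin.consEquiv_apply, List.finRange_succ, List.filter_cons, List.filter_map,
        Fin.prod_univ_succ, Fin.cons_zero, Fin.cons_succ, smul_smul]
      simp only [Fin.succ_lt_succ_iff, Fin.succ_pos, Fin.not_lt_zero, and_false, and_true,
        if_false, Bool.false_eq_true, Finset.prod_const_one, one_mul, Bool.not_false,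
        if_true, Finset.prod_mul_distrib]
      congr 1
      swap
      · simp [Function.comp_def]
      rw [mul_comm]
      congr 1
      rw [listDeg_filter_map, Finset.mul_sum, parity_sum]
      refine Finset.prod_congr rfl fun i _ => ?_
      split_ifs <;> simp [mul_comm]

theorem ofFn_eq_filter_map {n k : ℕ} {α : Type*} (x : Fin n → α) (c : Fin n → Bool)
    (f : Fin k → Fin n) (hf : StrictMono f) (hc : ∀ i, c i = true ↔ i ∈ Set.range f) :
    List.ofFn (fun i => x (f i)) = ((List.finRange n).filter c).map x := by
  have h : List.ofFn f = (List.finRange n).filter c := by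
    refine List.Perm.eq_of_pairwise (le := (· < ·)) ?_ ?_ ?_ ?_
    · intro a b _ _ h1 h2
      exact absurd h1 (lt_asymm h2)
    · exact List.pairwise_ofFn.mpr fun i j hij => hf hij
    · exact (List.pairwise_lt_finRange n).filter _
    · refine (List.perm_ext_iff_of_nodup ?_ ?_).mpr fun a => ?_
      · exact List.nodup_ofFn.mpr hf.injective
      · exact (List.nodup_finRange n).filter _
      · simp [hc]
  rw [← h, List.map_ofFn]
  rfl

/-- The indicator of the image of the first `k` indices. -/
def firstBlock (k : ℕ) {n : ℕ} (σ : Equiv.Perm (Fin n)) : Fin n → Bool :=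
  fun i => decide ((σ.symm i : ℕ) < k)

theorem mem_unshuffles {k n : ℕ} {σ : Equiv.Perm (Fin n)} : σ ∈ unshuffles k n ↔
    (∀ i j : Fin n, i < j → (j : ℕ) < k → σ i < σ j) ∧
    (∀ i j : Fin n, i < j → k ≤ (i : ℕ) → σ i < σ j) := by
  simp [unshuffles]

theorem strictMono_left_of_mem_unshuffles {k l : ℕ} {σ : Equiv.Perm (Fin (k + l))}
    (h : σ ∈ unshuffles k (k + l)) : StrictMono fun i : Fin k => σ (Fin.castAdd l i) :=
  fun i j hij => (mem_unshuffles.mp h).1 _ _ hij (by simp)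

theorem strictMono_right_of_mem_unshuffles {k l : ℕ} {σ : Equiv.Perm (Fin (k + l))}
    (h : σ ∈ unshuffles k (k + l)) : StrictMono fun i : Fin l => σ (Fin.natAdd k i) :=
  fun i j hij => (mem_unshuffles.mp h).2 _ _ (by simpa using hij) (by simp)

theorem firstBlock_eq_true_iff {k l : ℕ} (σ : Equiv.Perm (Fin (k + l))) (i : Fin (k + l)) :
    firstBlock k σ i = true ↔ i ∈ Set.range fun i : Fin k => σ (Fin.castAdd l i) := by
  rw [firstBlock, decide_eq_true_iff, Set.mem_range]
  constructor
  · intro h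
    exact ⟨⟨_, h⟩, by rw [Fin.castAdd_mk, Fin.eta, σ.apply_symm_apply]⟩
  · rintro ⟨j, rfl⟩
    simp

theorem not_firstBlock_eq_true_iff {k l : ℕ} (σ : Equiv.Perm (Fin (k + l)))
    (i : Fin (k + l)) :
    (!firstBlock k σ i) = true ↔ i ∈ Set.range fun i : Fin l => σ (Fin.natAdd k i) := by
  simp only [firstBlock, Bool.not_eq_true', decide_eq_false_iff_not, Set.mem_range, not_lt]
  constructor
  · intro h
    refine ⟨⟨(σ.symm i : ℕ) - k, by omega⟩, ?_⟩
    rw [← σ.eq_symm_apply]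
    ext
    simp
    omega
  · rintro ⟨j, rfl⟩
    simp

theorem koszulSign_unshuffle {k l : ℕ} (d : Fin (k + l) → ℤ) {σ : Equiv.Perm (Fin (k + l))}
    (h : σ ∈ unshuffles k (k + l)) :
    koszulSign d σ = ∏ i, ∏ j,
      if firstBlock k σ i = true ∧ firstBlock k σ j = false ∧ j < i then
        parity (d i * d j) else 1 := by
  rw [mem_unshuffles] at h
  rw [koszulSign, Finset.prod_filter, ← Finset.univ_product_univ, Finset.prod_product]
  refine Fintype.prod_equiv σ _ _ fun i => Fintype.prod_equiv σ _ _ fun j => ?_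
  refine if_congr ?_ rfl rfl
  simp only [firstBlock, σ.symm_apply_apply, decide_eq_true_iff, decide_eq_false_iff_not]
  constructor
  · rintro ⟨h1, h2⟩
    refine ⟨?_, ?_, h2⟩
    · by_contra h3
      exact lt_asymm h2 (h.2 i j h1 (not_lt.mp h3))
    · intro h3
      exact lt_asymm h2 (h.1 i j h1 h3)
  · rintro ⟨h1, h2, h3⟩
    exact ⟨Fin.lt_def.mpr (by omega), h3⟩

theorem firstBlock_injOn (k l : ℕ) :
    Set.InjOn (firstBlock k) (unshuffles k (k + l) : Set (Equiv.Perm (Fin (k + l)))) := by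
  intro σ hσ τ hτ h
  have hl := (strictMono_left_of_mem_unshuffles hσ).range_inj
    (strictMono_left_of_mem_unshuffles hτ) |>.mp (by
      ext i
      rw [← firstBlock_eq_true_iff, ← firstBlock_eq_true_iff, h])
  have hr := (strictMono_right_of_mem_unshuffles hσ).range_inj
    (strictMono_right_of_mem_unshuffles hτ) |>.mp (by
      ext i
      rw [← not_firstBlock_eq_true_iff, ← not_firstBlock_eq_true_iff, h])
  ext i
  refine Fin.addCases (fun i => ?_) (fun i => ?_) i
  · exact congrArg Fin.val (congrFun hl i)
  · exact congrArg Fin.val (congrFun hr i)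

theorem exists_unshuffle {k l : ℕ} (c : Fin (k + l) → Bool)
    (hc : ((List.finRange (k + l)).filter c).length = k) :
    ∃ σ ∈ unshuffles k (k + l), firstBlock k σ = c := by
  let s : Finset (Fin (k + l)) := Finset.univ.filter fun i => c i = true
  have hs : s.card = k := by
    refine Eq.trans ?_ hc
    have : s = ((List.finRange (k + l)).filter c).toFinset := by ext; simp [s]
    rw [this, List.toFinset_card_of_nodup ((List.nodup_finRange _).filter _)]
  have hs' : sᶜ.card = l := by rw [Finset.card_compl, hs, Fintype.card_fin]; omega
  let σ : Equiv.Perm (Fin (k + l)) := finSumFinEquiv.symm.trans (finSumEquivOfFinset hs hs')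
  have hleft : ∀ i : Fin k, σ (Fin.castAdd l i) = s.orderEmbOfFin hs i := fun i => by
    simp [σ]
  have hright : ∀ i : Fin l, σ (Fin.natAdd k i) = sᶜ.orderEmbOfFin hs' i := fun i => by
    simp [σ]
  refine ⟨σ, mem_unshuffles.mpr ⟨fun i j => ?_, fun i j => ?_⟩, ?_⟩
  · refine Fin.addCases (fun i => ?_) (fun i => ?_) i <;>
      refine Fin.addCases (fun j => ?_) (fun j => ?_) j
    · intro hij _
      rw [hleft, hleft]
      exact (s.orderEmbOfFin hs).strictMono hij
    · intro _ h
      simp at h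
    · intro hij h
      rw [Fin.lt_def] at hij
      simp at hij h
      omega
    · intro _ h
      simp at h
  · refine Fin.addCases (fun i => ?_) (fun i => ?_) i <;>
      refine Fin.addCases (fun j => ?_) (fun j => ?_) j
    · intro _ h
      simp at h
      omega
    · intro _ h
      simp at h
      omega
    · intro hij h
      rw [Fin.lt_def] at hij
      simp at hij h
      omega
    · intro hij _
      rw [hright, hright]
      exact (sᶜ.orderEmbOfFin hs').strictMono (by simpa using hij)
  · ext i
    have : firstBlock k σ i = true ↔ c i = true := by
      rw [firstBlock_eq_true_iff]
      simp only [hleft]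
      rw [Finset.range_orderEmbOfFin]
      simp [s]
    exact Bool.eq_iff_iff.mpr this

/-- A sum over unshuffles is a signed sum over splittings of a list. -/
theorem sum_unshuffles {k l : ℕ} (x : Fin (k + l) → ℤ × V)
    (F : List (ℤ × V) → List (ℤ × V) → V) :
    ∑ σ ∈ unshuffles k (k + l), koszulSign (fun i => (x i).1) σ •
      F (List.ofFn fun i : Fin k => x (σ (Fin.castAdd l i)))
        (List.ofFn fun j : Fin l => x (σ (Fin.natAdd k j))) =
      splitSum (List.ofFn x) (fun S T => if S.length = k then F S T else 0) := by
  have hF : ∀ σ ∈ unshuffles k (k + l),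
      (List.ofFn fun i : Fin k => x (σ (Fin.castAdd l i))) =
        ((List.finRange (k + l)).filter (firstBlock k σ)).map x ∧
      (List.ofFn fun j : Fin l => x (σ (Fin.natAdd k j))) =
        ((List.finRange (k + l)).filter (fun i => !firstBlock k σ i)).map x := fun σ hσ =>
    ⟨ofFn_eq_filter_map x _ _ (strictMono_left_of_mem_unshuffles hσ)
        (firstBlock_eq_true_iff σ),
      ofFn_eq_filter_map x _ _ (strictMono_right_of_mem_unshuffles hσ)
        (not_firstBlock_eq_true_iff σ)⟩
  rw [splitSum_ofFn]
  refine Finset.sum_of_injOn (firstBlock k) (firstBlock_injOn k l) (fun _ _ => by simp) ?_ ?_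
  · intro c _ hc
    rw [if_neg, smul_zero]
    rw [List.length_map]
    exact fun h => hc (exists_unshuffle c h)
  · intro σ hσ
    rw [if_pos, koszulSign_unshuffle _ hσ, (hF σ hσ).1, (hF σ hσ).2]
    rw [← (hF σ hσ).1, List.length_ofFn]

end Unshuffles

section Represents

variable {V : Type*} [AddCommGroup V] [Module ℝ V]

/-- The form `K` is the restriction of the function `f` to lists of homogeneous elements. -/
def Represents {𝒢 : ℤ → Submodule ℝ V} {k : ℕ} (K : GForm 𝒢 k) (f : List (ℤ × V) → V) : Prop :=
  ∀ d x, K d x = f (List.ofFn fun i => (d i, (x i : V)))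

variable {𝒢 : ℤ → Submodule ℝ V}

theorem isHomog_ofFn {n : ℕ} (d : Fin n → ℤ) (x : (i : Fin n) → 𝒢 (d i)) :
    IsHomog 𝒢 (List.ofFn fun i => (d i, (x i : V))) := by
  intro p hp
  obtain ⟨i, rfl⟩ := (List.mem_ofFn' _ _).mp hp
  exact (x i).2

theorem Represents.castForm {m n : ℕ} {K : GForm 𝒢 m} {f : List (ℤ × V) → V}
    (hK : Represents K f) (h : m = n) : Represents (castForm h K) f := by
  subst h
  exact hK

theorem Represents.smul {k : ℕ} {K : GForm 𝒢 k} {f : List (ℤ × V) → V}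
    (hK : Represents K f) (c : ℝ) : Represents (c • K) (fun L => c • f L) := fun d x => by
  rw [Pi.smul_apply, Pi.smul_apply, hK]

theorem Represents.insertionOp [DirectSum.Decomposition 𝒢] {k l : ℕ} (hkl : 0 < k + l) {δ : ℤ}
    {K : GForm 𝒢 k} {f : List (ℤ × V) → V} (hK : Represents K f)
    (hf : ∀ S, IsHomog 𝒢 S → f S ∈ 𝒢 (listDeg S + δ))
    {L : GForm 𝒢 l} {g : List (ℤ × V) → V} (hL : Represents L g) :
    Represents (insertionOp 𝒢 δ K L) (fun X => splitSum X (fun S T =>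
      if S.length = k then g ((listDeg S + δ, f S) :: T) else 0)) := by
  intro d x
  beta_reduce
  cases l with
  | zero =>
    refine Eq.trans (b := 0) rfl ?_
    rw [splitSum_congr (F' := fun _ _ => 0), splitSum_zero]
    intro S T h
    have := h.length_eq
    rw [List.length_append, List.length_ofFn] at this
    rw [if_neg (by omega)]
  | succ l =>
    suffices h : ∀ (d : Fin (k + l) → ℤ) (x : (i : Fin (k + l)) → 𝒢 (d i)),
        insertPos 𝒢 δ K L d x = splitSum (List.ofFn fun i => (d i, (x i : V))) (fun S T =>
          if S.length = k then g ((listDeg S + δ, f S) :: T) else 0) from h d x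
    intro d x
    rw [← sum_unshuffles (fun i => (d i, (x i : V)))
      (fun S T => g ((listDeg S + δ, f S) :: T))]
    refine Finset.sum_congr rfl fun σ _ => ?_
    congr 1
    have hdeg : listDeg (List.ofFn fun i : Fin k =>
        (d (σ (Fin.castAdd l i)), (x (σ (Fin.castAdd l i)) : V))) =
        ∑ i : Fin k, d (σ (Fin.castAdd l i)) := by
      rw [listDeg, List.map_ofFn, List.sum_ofFn]
      rfl
    have hval : ((prj 𝒢 (∑ i : Fin k, d (σ (Fin.castAdd l i)) + δ)
        (K (fun i => d (σ (Fin.castAdd l i))) (fun i => x (σ (Fin.castAdd l i))))) : V) =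
        f (List.ofFn fun i : Fin k =>
          (d (σ (Fin.castAdd l i)), (x (σ (Fin.castAdd l i)) : V))) := by
      rw [hK, prj, DirectSum.decompose_of_mem_same]
      rw [← hdeg]
      exact hf _ (isHomog_ofFn _ fun i => x (σ (Fin.castAdd l i)))
    rw [hL, List.ofFn_succ, hdeg, ← hval]
    rfl

end Represents

section Brackets

variable {V : Type*} [AddCommGroup V] [Module ℝ V] {𝒜 : ℤ → Submodule ℝ V}
  (G : Gerstenhaber 𝒜)

theorem wedgeAll_eq_listProd {k : ℕ} (d : Fin (k + 1) → ℤ) (v : Fin (k + 1) → V) :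
    wedgeAll G v = G.listProd (List.ofFn fun i => (d i, v i)) := by
  induction k with
  | zero => rfl
  | succ k ih =>
    rw [List.ofFn_succ, wedgeAll, ih (fun i => d i.succ), G.wedge_listProd _ (by simp)]
    rfl

theorem represents_mathcalN (𝒢 : ℤ → Submodule ℝ V) (k : ℕ) :
    Represents (mathcalN G 𝒢 k) G.listProd := by
  intro d x
  cases k with
  | zero => rfl
  | succ k => exact wedgeAll_eq_listProd G d _

theorem represents_l2G (𝒢 : ℤ → Submodule ℝ V) : Represents (l2G G 𝒢) G.listPair :=
  fun _ _ => rfl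

theorem splitSum_bracket_smul (α γ : ℝ) {p q : ℕ} {L : List (ℤ × V)}
    (hL : IsHomog (negG 𝒜) L) (hpq : p + q = L.length + 1) :
    splitSum L (fun U Z => if U.length = p then
        γ • G.listL ((listDeg U + 0, α • G.listProd U) :: Z) else 0) -
      splitSum L (fun S T => if S.length = q then
        α • G.listProd ((listDeg S + 1, γ • G.listL S) :: T) else 0) =
      (if p = 0 then 0 else α * γ * (L.length - 1).choose p) • G.listL L := by
  have h1 : splitSum L (fun U Z => if U.length = p then
        γ • G.listL ((listDeg U + 0, α • G.listProd U) :: Z) else 0) =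
      (α * γ) • splitSum L (fun U Z => if U.length = p then
        G.listL ((listDeg U, G.listProd U) :: Z) else 0) := by
    rw [smul_splitSum]
    refine splitSum_congr fun S T _ => ?_
    rw [add_zero, G.listL_cons_smul, smul_smul, mul_comm, smul_ite, smul_zero]
  have h2 : splitSum L (fun S T => if S.length = q then
        α • G.listProd ((listDeg S + 1, γ • G.listL S) :: T) else 0) =
      (α * γ) • splitSum L (fun S T =>
        if S.length = q then G.mulList (G.listL S) T else 0) := by
    rw [smul_splitSum]
    refine splitSum_congr fun S T _ => ?_
    rw [Gerstenhaber.listProd, G.mulList_smul, smul_smul, smul_ite, smul_zero]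
  rw [h1, h2, ← smul_sub]
  rcases Nat.eq_zero_or_pos p with rfl | hp
  · rw [if_pos rfl, zero_smul]
    have h3 : splitSum L (fun U Z => if U.length = 0 then
        G.listL ((listDeg U, G.listProd U) :: Z) else 0) = 0 := by
      rw [splitSum_congr (F' := fun _ _ => 0), splitSum_zero]
      intro S T _
      split_ifs with h
      · rw [List.length_eq_zero_iff.mp h, Gerstenhaber.listProd]
        simpa using G.listL_cons_smul 0 0 0 T
      · rfl
    have h4 : splitSum L (fun S T =>
        if S.length = q then G.mulList (G.listL S) T else 0) = 0 := by
      rw [splitSum_congr (F' := fun _ _ => 0), splitSum_zero]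
      intro S T h
      have := h.length_eq
      rw [List.length_append] at this
      rw [if_neg (by omega)]
    rw [h3, h4, sub_zero, smul_zero]
  · rw [G.splitSum_bracket hp hL hpq, if_neg (by omega), mul_smul (α * γ), Nat.cast_smul_eq_nsmul]

variable [DirectSum.Decomposition (negG 𝒜)]

theorem represents_lFormsG (n : ℕ) : Represents (lFormsG G (negG 𝒜) n) G.listL := by
  match n with
  | 0 => exact fun d x => (G.listL_eq_zero (by simp)).symm
  | 1 => exact fun d x => (G.listL_eq_zero (by simp)).symm
  | 2 =>
    intro d x
    rw [lFormsG, represents_l2G G _ d x]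
    simp [Gerstenhaber.listL, splitSum, Gerstenhaber.listPair, Gerstenhaber.mulList]
  | n + 3 =>
    have h := ((represents_l2G G (negG 𝒜)).insertionOp (l := n + 2) (by omega)
      (fun S hS => G.listPair_mem hS) (represents_mathcalN G (negG 𝒜) (n + 2))).castForm
      (show 2 + (n + 2) - 1 = n + 3 by omega)
    intro d x
    rw [lFormsG, h, Gerstenhaber.listL]
    refine splitSum_congr fun S T _ => ?_
    split_ifs with hS
    · rfl
    · rw [G.listPair_eq_zero hS, G.mulList_zero]

theorem lFormsG_eq_zero {n : ℕ} (hn : n < 2) : lFormsG G (negG 𝒜) n = 0 := by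
  funext d x
  rw [represents_lFormsG, G.listL_eq_zero (by simpa using hn)]
  rfl

/-- The bracket of a combination of the `𝒩_k` with a combination of the `l_k`. -/
theorem rnBracketM_mathcalN_lFormsG (a c : ℕ → ℝ) :
    rnBracketM (negG 𝒜) 0 1 (fun k => a k • mathcalN G (negG 𝒜) k)
        (fun k => c k • lFormsG G (negG 𝒜) k) =
      fun m => (∑ p ∈ Finset.Icc 1 (m + 1), a p * c (m + 1 - p) * (m - 1).choose p) •
        lFormsG G (negG 𝒜) m := by
  funext m d x
  let X := List.ofFn fun i => (d i, (x i : V))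
  let A : ℕ → V := fun p => splitSum X (fun U Z => if U.length = p then
        c (m + 1 - p) • G.listL ((listDeg U + 0, a p • G.listProd U) :: Z) else 0)
  let B : ℕ → ℕ → V := fun q p => splitSum X (fun S T => if S.length = q then
        a p • G.listProd ((listDeg S + 1, c q • G.listL S) :: T) else 0)
  have hA : ∀ p (hp : p ∈ Finset.range (m + 2)) (h : p + (m + 1 - p) - 1 = m),
      castForm h (insertionOp (negG 𝒜) 0 (a p • mathcalN G (negG 𝒜) p)
        (c (m + 1 - p) • lFormsG G (negG 𝒜) (m + 1 - p))) d x = A p := fun p hp h =>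
    (((represents_mathcalN G _ p).smul (a p)).insertionOp (by omega)
      (fun S hS => by
        rw [add_zero]
        exact Submodule.smul_mem _ _ (G.listProd_mem hS))
      ((represents_lFormsG G _).smul (c (m + 1 - p)))).castForm h d x
  have hB : ∀ q (hq : q ∈ Finset.range (m + 2)) (h : q + (m + 1 - q) - 1 = m),
      castForm h (insertionOp (negG 𝒜) 1 (c q • lFormsG G (negG 𝒜) q)
        (a (m + 1 - q) • mathcalN G (negG 𝒜) (m + 1 - q))) d x = B q (m + 1 - q) :=
    fun q hq h =>
    (((represents_lFormsG G q).smul (c q)).insertionOp (by omega)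
      (fun S hS => Submodule.smul_mem _ _ (G.listL_mem hS))
      ((represents_mathcalN G _ _).smul (a (m + 1 - q)))).castForm h d x
  have hsumB : ∑ q ∈ Finset.range (m + 2), B q (m + 1 - q) =
      ∑ p ∈ Finset.range (m + 2), B (m + 1 - p) p := by
    rw [← Finset.sum_range_reflect]
    refine Finset.sum_congr rfl fun p hp => ?_
    rw [Finset.mem_range] at hp
    congr 1
    omega
  calc _ = (∑ p ∈ Finset.range (m + 2), A p) - ∑ q ∈ Finset.range (m + 2), B q (m + 1 - q) := by
        rw [← Finset.sum_attach (Finset.range (m + 2)) A,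
          ← Finset.sum_attach (Finset.range (m + 2)) (fun q => B q (m + 1 - q))]
        simp only [rnBracketM, Pi.sub_apply, Finset.sum_apply, zero_mul,
          Int.natAbs_zero, pow_zero, one_smul]
        congr 1
        · exact Finset.sum_congr rfl fun p _ => hA _ p.2 _
        · exact Finset.sum_congr rfl fun p _ => hB _ p.2 _
    _ = ∑ p ∈ Finset.range (m + 2),
          (if p = 0 then 0 else a p * c (m + 1 - p) * (m - 1).choose p) • G.listL X := by
        rw [hsumB, ← Finset.sum_sub_distrib]
        refine Finset.sum_congr rfl fun p hp => ?_
        rw [Finset.mem_range] at hp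
        have := splitSum_bracket_smul G (a p) (c (m + 1 - p)) (p := p) (q := m + 1 - p)
          (isHomog_ofFn d x) (by rw [List.length_ofFn]; omega)
        rw [List.length_ofFn] at this
        exact this
    _ = _ := by
        rw [Pi.smul_apply, Pi.smul_apply, represents_lFormsG G m d x, ← Finset.sum_smul]
        congr 1
        rw [Finset.sum_range_succ', if_pos rfl, add_zero, Finset.range_eq_Ico,
          Finset.sum_Ico_add' (fun p => if p = 0 then 0 else
            a p * c (m + 1 - p) * (m - 1).choose p) 0 (m + 1) 1]
        refine Finset.sum_congr (by ext; simp) fun p hp => ?_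
        rw [if_neg]
        rw [Finset.mem_Icc] at hp
        omega

theorem singleF_lFormsG (n : ℕ) : singleF (negG 𝒜) n (lFormsG G (negG 𝒜) n) =
    fun k => (if k = n then (1 : ℝ) else 0) • lFormsG G (negG 𝒜) k := by
  funext k
  rw [singleF]
  split_ifs with h
  · subst h
    rw [one_smul]
    rfl
  · rw [zero_smul]

end Brackets

theorem sum_Icc_mul_ite {n : ℕ} (hn : 1 ≤ n) (M : ℕ) (f g : ℕ → ℝ) :
    ∑ p ∈ Finset.Icc 1 M, f p * (if M - p = n then 1 else 0) * g p =
      if n < M then f (M - n) * g (M - n) else 0 := by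
  split_ifs with h
  · rw [Finset.sum_eq_single (M - n)]
    · rw [if_pos (by omega), mul_one]
    · intro p hp hne
      rw [Finset.mem_Icc] at hp
      rw [if_neg (by omega), mul_zero, zero_mul]
    · intro hp
      rw [Finset.mem_Icc] at hp
      omega
  · refine Finset.sum_eq_zero fun p hp => ?_
    rw [Finset.mem_Icc] at hp
    rw [if_neg (by omega), mul_zero, zero_mul]

theorem square_coefficient_identity (b : ℕ → ℝ) {n m : ℕ} (hn : 1 ≤ n) (hm : 2 ≤ m) :
    ∑ q ∈ Finset.Icc 1 (m + 1), b q * (∑ p ∈ Finset.Icc 1 (m + 1 - q + 1),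
        b p * (if m + 1 - q + 1 - p = n then 1 else 0) * (m + 1 - q - 1).choose p) *
        (m - 1).choose q =
      ∑ k ∈ Finset.Icc 1 (m + 1), (∑ i ∈ Finset.Icc 1 k,
        b i * b (k + 1 - i) *
          (((Nat.choose (i + n - 2) i : ℝ) *
              (Nat.choose (i + (k + 1 - i) + n - 3) (k + 1 - i) : ℝ)) /
            (Nat.choose (i + (k + 1 - i) + n - 3) (i + (k + 1 - i) - 1) : ℝ))) *
        (if m + 1 - k = n then 1 else 0) * (m - 1).choose k := by
  rw [sum_Icc_mul_ite hn (m + 1) (fun k => ∑ i ∈ Finset.Icc 1 k, b i * b (k + 1 - i) *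
    (((Nat.choose (i + n - 2) i : ℝ) *
        (Nat.choose (i + (k + 1 - i) + n - 3) (k + 1 - i) : ℝ)) /
      (Nat.choose (i + (k + 1 - i) + n - 3) (i + (k + 1 - i) - 1) : ℝ)))
    (fun k => (m - 1).choose k)]
  simp only [fun q => sum_Icc_mul_ite hn (m + 1 - q + 1) b
    (fun p => ((m + 1 - q - 1).choose p : ℝ))]
  rcases Nat.lt_or_ge n (m + 1) with hlt | hge
  · obtain ⟨r, hr⟩ : ∃ r, m + 1 - n = r := ⟨_, rfl⟩
    rw [if_pos hlt, hr, Finset.sum_mul]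
    have hsub : Finset.Icc 1 r ⊆ Finset.Icc 1 (m + 1) :=
      Finset.Icc_subset_Icc le_rfl (by omega)
    rw [← Finset.sum_subset hsub]
    · refine Finset.sum_nbij' (fun q => r + 1 - q) (fun q => r + 1 - q) ?_ ?_ ?_ ?_ ?_
      · intro q hq
        rw [Finset.mem_Icc] at hq ⊢
        omega
      · intro q hq
        rw [Finset.mem_Icc] at hq ⊢
        omega
      · intro q hq
        rw [Finset.mem_Icc] at hq
        omega
      · intro q hq
        rw [Finset.mem_Icc] at hq
        omega
      · intro q hq
        rw [Finset.mem_Icc] at hq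
        rw [if_pos (by omega), show m + 1 - q + 1 - n = r + 1 - q by omega,
          show r + 1 - (r + 1 - q) = q by omega,
          show r + 1 - q + q - 1 = r by omega]
        rcases Nat.lt_or_ge n 2 with hn2 | hn2
        · rw [Nat.choose_eq_zero_of_lt (show m + 1 - q - 1 < r + 1 - q by omega),
            Nat.choose_eq_zero_of_lt (show m - 1 < r by omega)]
          simp
        · rw [show r + 1 - q + q + n - 3 = m - 1 by omega,
            show r + 1 - q + n - 2 = m + 1 - q - 1 by omega]
          have hne : ((m - 1).choose r : ℝ) ≠ 0 :=
            Nat.cast_ne_zero.mpr (Nat.choose_pos (by omega)).ne'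
          field_simp
    · intro q hq hq'
      rw [Finset.mem_Icc] at hq hq'
      rw [if_neg (by omega), mul_zero, zero_mul]
  · rw [if_neg (by omega)]
    refine Finset.sum_eq_zero fun q hq => ?_
    rw [Finset.mem_Icc] at hq
    rw [if_neg (by omega), mul_zero, zero_mul]

/-- For any real coefficients `(b_i)`, `𝒩 = Σ_{i≥1} b_i 𝒩_i` is
co-boundary Nijenhuis with respect to `l_n` (`n ≥ 1`), with square
`𝒦 = Σ_{i,j≥1} b_i b_j (binom(i+n-2,i)·binom(i+j+n-3,j)/binom(i+j+n-3,i+j-1)) 𝒩_{i+j-1}`. -/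
theorem nijenhuis_sum_coboundary
    {V : Type*} [AddCommGroup V] [Module ℝ V] {𝒜 : ℤ → Submodule ℝ V}
    (G : Gerstenhaber 𝒜) [DirectSum.Decomposition (negG 𝒜)]
    (b : ℕ → ℝ) (n : ℕ) (hn : 1 ≤ n) :
    rnBracketM (negG 𝒜) 0 1 (fun k => b k • mathcalN G (negG 𝒜) k)
        (rnBracketM (negG 𝒜) 0 1 (fun k => b k • mathcalN G (negG 𝒜) k)
          (singleF (negG 𝒜) n (lFormsG G (negG 𝒜) n)))
      = rnBracketM (negG 𝒜) 0 1
          (fun k =>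
            (∑ i ∈ Finset.Icc 1 k,
              b i * b (k + 1 - i) *
                (((Nat.choose (i + n - 2) i : ℝ) *
                    (Nat.choose (i + (k + 1 - i) + n - 3) (k + 1 - i) : ℝ)) /
                  (Nat.choose (i + (k + 1 - i) + n - 3) (i + (k + 1 - i) - 1) : ℝ))) •
              mathcalN G (negG 𝒜) k)
          (singleF (negG 𝒜) n (lFormsG G (negG 𝒜) n)) := by
  rw [singleF_lFormsG, rnBracketM_mathcalN_lFormsG, rnBracketM_mathcalN_lFormsG,
    rnBracketM_mathcalN_lFormsG]
  funext m
  rcases Nat.lt_or_ge m 2 with hm | hm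
  · rw [lFormsG_eq_zero G hm, smul_zero, smul_zero]
  · rw [square_coefficient_identity b hn hm]
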